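/- For every d ≥ 3 and every n ≥ 1 there exist convex sets K₁, …, Kₙ ⊆ ℝ^d such that the set S = ℝ^d \ (K₁ ∪ … ∪ Kₙ) has exactly C(n, 2) = n(n−1)/2 distinct (d−1)-ordinary flats (ordinary hyperplanes). -/

import Mathlib

open Metric Set Module

/-- `HasSimplex S k` : the set `S` contains a `k`-simplex, i.e. the convex hull
of `k+1` affinely independent points. -/
def HasSimplex {d : ℕ} (S : Set (EuclideanSpace ℝ (Fin d))) (k : ℕ) : Prop :=
  ∃ f : Fin (k + 1) → EuclideanSpace ℝ (Fin d),
    AffineIndependent ℝ f ∧ convexHull ℝ (Set.range f) ⊆ S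

/-- The flat-dimension `dm S` of a set `S ⊆ ℝ^d`: the maximal `k` such that `S`
contains a `k`-simplex. -/
noncomputable def dm {d : ℕ} (S : Set (EuclideanSpace ℝ (Fin d))) : ℕ :=
  sSup {k : ℕ | HasSimplex S k}

/-- The local dimension `dmLoc S p` of `S` at `p`: the minimum over `ε > 0` of
the flat-dimension of `S ∩ B(p, ε)`. -/
noncomputable def dmLoc {d : ℕ} (S : Set (EuclideanSpace ℝ (Fin d)))
    (p : EuclideanSpace ℝ (Fin d)) : ℕ :=
  sInf {m : ℕ | ∃ ε > 0, m = dm (S ∩ ball p ε)}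

/-- `p` is a `k`-ordinary point of `S`: its local dimension is `k` and, near `p`,
`S` coincides with a `k`-flat. -/
def IsOrdinaryPoint {d : ℕ} (S : Set (EuclideanSpace ℝ (Fin d))) (k : ℕ)
    (p : EuclideanSpace ℝ (Fin d)) : Prop :=
  p ∈ S ∧ dmLoc S p = k ∧
    ∃ H : AffineSubspace ℝ (EuclideanSpace ℝ (Fin d)),
      finrank ℝ H.direction = k ∧
      ∃ U, IsOpen U ∧ p ∈ U ∧ S ∩ U = (H : Set (EuclideanSpace ℝ (Fin d))) ∩ U

/-- `H` is a `k`-ordinary flat of `S`: `H` is a `k`-flat which witnesses some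
`k`-ordinary point of `S`. -/
def IsOrdinaryFlat {d : ℕ} (S : Set (EuclideanSpace ℝ (Fin d))) (k : ℕ)
    (H : AffineSubspace ℝ (EuclideanSpace ℝ (Fin d))) : Prop :=
  finrank ℝ H.direction = k ∧
    ∃ p ∈ S, dmLoc S p = k ∧
      ∃ U, IsOpen U ∧ p ∈ U ∧ S ∩ U = (H : Set (EuclideanSpace ℝ (Fin d))) ∩ U

theorem HasSimplex.mono {d : ℕ} {S T : Set (EuclideanSpace ℝ (Fin d))} (h : S ⊆ T) {k : ℕ}
    (hS : HasSimplex S k) : HasSimplex T k := by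
  obtain ⟨f, hf, hfS⟩ := hS
  exact ⟨f, hf, hfS.trans h⟩

theorem HasSimplex.le_finrank_direction {d : ℕ} {S : Set (EuclideanSpace ℝ (Fin d))} {k : ℕ}
    (hS : HasSimplex S k) {H : AffineSubspace ℝ (EuclideanSpace ℝ (Fin d))}
    (h : S ⊆ H) : k ≤ finrank ℝ H.direction := by
  obtain ⟨f, hf, hfS⟩ := hS
  rw [← hf.finrank_vectorSpan (n := k) (by simp)]
  apply Submodule.finrank_mono
  exact vectorSpan_mono ℝ ((subset_convexHull ℝ _).trans (hfS.trans h))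

theorem hasSimplex_inter_ball {d : ℕ} {H : AffineSubspace ℝ (EuclideanSpace ℝ (Fin d))}
    {p : EuclideanSpace ℝ (Fin d)} (hp : p ∈ H) {ε : ℝ} (hε : 0 < ε) :
    HasSimplex ((H : Set (EuclideanSpace ℝ (Fin d))) ∩ ball p ε) (finrank ℝ H.direction) := by
  let b := stdOrthonormalBasis ℝ H.direction
  have hlin : LinearIndependent ℝ fun i => (b i : EuclideanSpace ℝ (Fin d)) :=
    b.orthonormal.linearIndependent.map' H.direction.subtype (Submodule.ker_subtype _)
  refine ⟨Fin.cons p fun i => (ε / 2) • (b i : EuclideanSpace ℝ (Fin d)) + p, ?_, ?_⟩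
  · rw [affineIndependent_iff_linearIndependent_vsub ℝ _ 0,
      ← linearIndependent_equiv (finSuccAboveEquiv 0)]
    have hsmul := hlin.units_smul fun _ => Units.mk0 (ε / 2) (by positivity)
    convert hsmul using 1
    · ext1 i
      have hi : (finSuccAboveEquiv (0 : Fin (finrank ℝ H.direction + 1)) i).1 = i.succ := by
        simp [finSuccAboveEquiv_apply]
      rw [Function.comp_apply, hi, Fin.cons_succ, Fin.cons_zero]
      simp [Units.smul_def]
    · rfl
  · refine convexHull_min ?_ (H.convex.inter (convex_ball p ε))
    rintro _ ⟨i, rfl⟩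
    refine Fin.cases ?_ (fun i => ?_) i
    · exact ⟨hp, mem_ball_self hε⟩
    · refine ⟨AffineSubspace.vadd_mem_of_mem_direction
        (H.direction.smul_mem _ (b i).2) hp, ?_⟩
      have hb : ‖(b i : EuclideanSpace ℝ (Fin d))‖ = 1 := b.orthonormal.1 i
      simp [norm_smul, hb, abs_of_pos hε]
      linarith

theorem bddAbove_hasSimplex {d : ℕ} (S : Set (EuclideanSpace ℝ (Fin d))) :
    BddAbove {k : ℕ | HasSimplex S k} :=
  ⟨_, fun _ hk => HasSimplex.le_finrank_direction (S := S) hk (H := ⊤) (by simp)⟩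

theorem dmLoc_eq_finrank_direction {d : ℕ} {S : Set (EuclideanSpace ℝ (Fin d))}
    {H : AffineSubspace ℝ (EuclideanSpace ℝ (Fin d))} {p : EuclideanSpace ℝ (Fin d)}
    {U : Set (EuclideanSpace ℝ (Fin d))} (hU : IsOpen U) (hpU : p ∈ U) (hp : p ∈ H)
    (h : S ∩ U = (H : Set (EuclideanSpace ℝ (Fin d))) ∩ U) :
    dmLoc S p = finrank ℝ H.direction := by
  obtain ⟨δ, hδ, hδU⟩ := Metric.isOpen_iff.1 hU p hpU
  have hle : ∀ ε > 0, finrank ℝ H.direction ≤ dm (S ∩ ball p ε) := by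
    intro ε hε
    refine le_csSup (bddAbove_hasSimplex _)
      ((hasSimplex_inter_ball hp (lt_min hε hδ)).mono ?_)
    rintro x ⟨hxH, hx⟩
    have hxU : x ∈ U := hδU (ball_subset_ball (min_le_right _ _) hx)
    exact ⟨(h.symm.subset (mem_inter hxH hxU)).1, ball_subset_ball (min_le_left _ _) hx⟩
  refine le_antisymm ?_ (le_csInf ⟨_, 1, one_pos, rfl⟩ ?_)
  · have hδm : dmLoc S p ≤ dm (S ∩ ball p δ) := Nat.sInf_le ⟨δ, hδ, rfl⟩
    refine hδm.trans (csSup_le' fun k hk => ?_)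
    exact HasSimplex.le_finrank_direction hk fun x hx => (h.subset ⟨hx.1, hδU hx.2⟩).1
  · rintro _ ⟨ε, hε, rfl⟩
    exact hle ε hε

/-- An affine subspace which is locally covered by finitely many affine subspaces is contained
in one of them. -/
theorem AffineSubspace.exists_le_of_inter_subset_iUnion {E ι : Type*} [NormedAddCommGroup E]
    [NormedSpace ℝ E] [Finite ι] {F : ι → AffineSubspace ℝ E} {H : AffineSubspace ℝ E} {p : E}
    (hp : p ∈ H) {U : Set E} (hU : IsOpen U) (hpU : p ∈ U)
    (h : (H : Set E) ∩ U ⊆ ⋃ i, (F i : Set E)) : ∃ i, H ≤ F i := by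
  by_contra! hF
  obtain ⟨v, hv⟩ := Submodule.exists_forall_notMem_of_forall_ne_top
    (fun i : {i // ¬ H.direction ≤ (F i).direction} =>
      (F i).direction.comap H.direction.subtype)
    (fun i hi => i.2 (Submodule.comap_subtype_eq_top.1 hi))
  have hcont : Continuous fun t : ℝ => t • (v : E) + p := by fun_prop
  have hT : {t : ℝ | t • (v : E) + p ∈ U} ∈ nhds 0 :=
    (hU.preimage hcont).mem_nhds (by simpa using hpU)
  refine infinite_of_mem_nhds 0 hT ?_
  refine (Set.finite_iUnion (f := fun i => {t : ℝ | t • (v : E) + p ∈ F i}) fun i => ?_).subset ?_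
  · refine Set.Subsingleton.finite fun s hs t ht => ?_
    by_contra hst
    have hdir : ¬ H.direction ≤ (F i).direction := by
      refine fun hle => hF i fun q hq => ?_
      have hmem : s • (v : E) + p ∈ H :=
        AffineSubspace.vadd_mem_of_mem_direction (H.direction.smul_mem _ v.2) hp
      simpa using AffineSubspace.vadd_mem_of_mem_direction
        (hle (AffineSubspace.vsub_mem_direction hq hmem)) hs
    apply hv ⟨i, hdir⟩
    have hsub : (s - t) • (v : E) ∈ (F i).direction := by
      have := AffineSubspace.vsub_mem_direction hs ht
      rwa [vsub_eq_sub, add_sub_add_right_eq_sub, ← sub_smul] at this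
    simpa using ((F i).direction.smul_mem_iff (sub_ne_zero.2 hst)).1 hsub
  · intro t ht
    simpa using h ⟨AffineSubspace.vadd_mem_of_mem_direction (H.direction.smul_mem t v.2) hp, ht⟩

/-- The affine function `x ↦ x₀ t + x₁ t² + x₂ t³ - t⁴` attached to the parameter `t`. -/
noncomputable def momentFun {e : ℕ} (t : ℝ) (x : EuclideanSpace ℝ (Fin (e + 3))) : ℝ :=
  x 0 * t + x 1 * t ^ 2 + x 2 * t ^ 3 - t ^ 4

theorem continuous_momentFun {e : ℕ} (t : ℝ) :
    Continuous (momentFun t : EuclideanSpace ℝ (Fin (e + 3)) → ℝ) := by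
  unfold momentFun
  fun_prop

/-- The linear part of the equation of the hyperplane on which the affine functions with
parameters `s` and `t` agree. -/
noncomputable def momentNormal {e : ℕ} (s t : ℝ) :
    EuclideanSpace ℝ (Fin (e + 3)) →ₗ[ℝ] ℝ where
  toFun x := x 0 + (s + t) * x 1 + (s ^ 2 + s * t + t ^ 2) * x 2
  map_add' x y := by simp; ring
  map_smul' c x := by simp; ring

/-- The point with first three coordinates `a`, `b`, `c` and all other coordinates zero. -/
noncomputable def firstThree {e : ℕ} (a b c : ℝ) : EuclideanSpace ℝ (Fin (e + 3)) :=
  EuclideanSpace.single 0 a + EuclideanSpace.single 1 b + EuclideanSpace.single 2 c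

@[simp]
theorem firstThree_zero {e : ℕ} (a b c : ℝ) :
    (firstThree a b c : EuclideanSpace ℝ (Fin (e + 3))) 0 = a := by
  simp [firstThree, Fin.ext_iff, Nat.mod_eq_of_lt (show 2 < e + 3 by omega)]

@[simp]
theorem firstThree_one {e : ℕ} (a b c : ℝ) :
    (firstThree a b c : EuclideanSpace ℝ (Fin (e + 3))) 1 = b := by
  simp [firstThree, Fin.ext_iff, Nat.mod_eq_of_lt (show 2 < e + 3 by omega)]

@[simp]
theorem firstThree_two {e : ℕ} (a b c : ℝ) :
    (firstThree a b c : EuclideanSpace ℝ (Fin (e + 3))) 2 = c := by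
  simp [firstThree, Fin.ext_iff, Nat.mod_eq_of_lt (show 2 < e + 3 by omega)]

/-- The hyperplane on which the affine functions with parameters `s` and `t` agree. -/
noncomputable def momentHyperplane (e : ℕ) (s t : ℝ) :
    AffineSubspace ℝ (EuclideanSpace ℝ (Fin (e + 3))) :=
  AffineSubspace.mk' (firstThree ((s + t) * (s ^ 2 + t ^ 2)) 0 0)
    (LinearMap.ker (momentNormal s t))

theorem mem_momentHyperplane {e : ℕ} {s t : ℝ} {x : EuclideanSpace ℝ (Fin (e + 3))} :
    x ∈ momentHyperplane e s t ↔ x 0 + (s + t) * x 1 + (s ^ 2 + s * t + t ^ 2) * x 2 =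
      (s + t) * (s ^ 2 + t ^ 2) := by
  rw [momentHyperplane, AffineSubspace.mem_mk', vsub_eq_sub, LinearMap.sub_mem_ker_iff]
  simp [momentNormal]

theorem mem_momentHyperplane_iff_momentFun_eq {e : ℕ} {s t : ℝ} (hst : s ≠ t)
    {x : EuclideanSpace ℝ (Fin (e + 3))} :
    x ∈ momentHyperplane e s t ↔ momentFun s x = momentFun t x := by
  rw [mem_momentHyperplane, ← sub_eq_zero, ← sub_eq_zero (a := momentFun s x),
    ← mul_eq_zero_iff_left (sub_ne_zero.2 hst)]
  unfold momentFun
  ring_nf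

theorem finrank_direction_momentHyperplane (e : ℕ) (s t : ℝ) :
    finrank ℝ (momentHyperplane e s t).direction = e + 2 := by
  rw [momentHyperplane, AffineSubspace.direction_mk']
  have hne : (momentNormal s t : Dual ℝ (EuclideanSpace ℝ (Fin (e + 3)))) ≠ 0 := by
    intro h
    simpa [momentNormal] using LinearMap.congr_fun h (firstThree 1 0 0)
  have := Module.Dual.finrank_ker_add_one_of_ne_zero hne
  rw [finrank_euclideanSpace_fin] at this
  omega

theorem momentHyperplane_injective {e : ℕ} {s t s' t' : ℝ} (hst : s < t) (hst' : s' < t')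
    (h : momentHyperplane e s t = momentHyperplane e s' t') : s = s' ∧ t = t' := by
  have key : ∀ x : EuclideanSpace ℝ (Fin (e + 3)),
      x ∈ momentHyperplane e s t → x ∈ momentHyperplane e s' t' := fun x hx => h ▸ hx
  simp only [mem_momentHyperplane] at key
  have h0 := key (firstThree ((s + t) * (s ^ 2 + t ^ 2)) 0 0) (by simp)
  have h1 := key (firstThree ((s + t) * (s ^ 2 + t ^ 2) - (s + t)) 1 0) (by simp)
  have h2 := key (firstThree ((s + t) * (s ^ 2 + t ^ 2) - (s ^ 2 + s * t + t ^ 2)) 0 1) (by simp)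
  simp only [firstThree_zero, firstThree_one, firstThree_two] at h0 h1 h2
  have hs : s + t = s' + t' := by linarith
  have hd : (t - s) ^ 2 = (t' - s') ^ 2 := by
    have hq : s ^ 2 + s * t + t ^ 2 = s' ^ 2 + s' * t' + t' ^ 2 := by linarith
    have hs2 : (s + t) ^ 2 = (s' + t') ^ 2 := by rw [hs]
    linarith
  have hd' : t - s = t' - s' := by
    rwa [sq_eq_sq₀ (by linarith) (by linarith)] at hd
  constructor <;> linarith

/-- The cell of the parameter `t i`: the region where its affine function strictly dominates
all the others. -/
def momentCell {e n : ℕ} (t : Fin n → ℝ) (i : Fin n) : Set (EuclideanSpace ℝ (Fin (e + 3))) :=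
  {x | ∀ j, j ≠ i → momentFun (t j) x < momentFun (t i) x}

theorem convex_momentCell {e n : ℕ} (t : Fin n → ℝ) (i : Fin n) :
    Convex ℝ (momentCell t i : Set (EuclideanSpace ℝ (Fin (e + 3)))) := by
  intro x hx y hy a b ha hb hab j hj
  have h := convex_Ioi (𝕜 := ℝ) (0 : ℝ) (mem_Ioi.2 (sub_pos.2 (hx j hj)))
    (mem_Ioi.2 (sub_pos.2 (hy j hj))) ha hb hab
  have hadd : ∀ s : ℝ, momentFun s (a • x + b • y) = a * momentFun s x + b * momentFun s y := by
    intro s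
    simp only [momentFun, PiLp.add_apply, PiLp.smul_apply, smul_eq_mul]
    linear_combination (s ^ 4) * hab
  rw [hadd, hadd]
  simp only [smul_eq_mul, mem_Ioi] at h
  linarith

theorem exists_mem_momentHyperplane_of_notMem_momentCell {e n : ℕ} (hn : 1 ≤ n) {t : Fin n → ℝ}
    (ht : StrictMono t) {x : EuclideanSpace ℝ (Fin (e + 3))} (hx : x ∈ (⋃ i, momentCell t i)ᶜ) :
    ∃ i j, i < j ∧ x ∈ momentHyperplane e (t i) (t j) := by
  have : Nonempty (Fin n) := ⟨⟨0, hn⟩⟩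
  obtain ⟨i, hi⟩ := Finite.exists_max fun i => momentFun (t i) x
  have hxi : x ∉ momentCell t i := fun h => hx (mem_iUnion.2 ⟨i, h⟩)
  simp only [momentCell, mem_ofPred_eq, not_forall, not_lt] at hxi
  obtain ⟨j, hji, hj⟩ := hxi
  have heq : momentFun (t i) x = momentFun (t j) x := le_antisymm hj (hi j)
  rcases lt_or_gt_of_ne hji with h | h
  · exact ⟨j, i, h, (mem_momentHyperplane_iff_momentFun_eq (ht h).ne).2 heq.symm⟩
  · exact ⟨i, j, h, (mem_momentHyperplane_iff_momentFun_eq (ht h).ne).2 heq⟩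

/-- A point at which exactly the affine functions with parameters `s` and `t` are maximal. -/
theorem exists_momentFun_eq_and_lt (e : ℕ) (s t : ℝ) :
    ∃ p : EuclideanSpace ℝ (Fin (e + 3)), momentFun s p = momentFun t p ∧
      ∀ r, r ≠ s → r ≠ t → momentFun r p < momentFun s p := by
  have hval : ∀ r : ℝ, momentFun r (firstThree (2 * s * t * (s + t)) (-((s + t) ^ 2 + 2 * s * t))
      (2 * (s + t)) : EuclideanSpace ℝ (Fin (e + 3))) =
      (s * t) ^ 2 - ((r - s) * (r - t)) ^ 2 := by
    intro r
    simp only [momentFun, firstThree_zero, firstThree_one, firstThree_two]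
    ring
  refine ⟨_, by rw [hval, hval]; ring, fun r hrs hrt => ?_⟩
  rw [hval, hval]
  have : 0 < ((r - s) * (r - t)) ^ 2 := by
    have := mul_ne_zero (sub_ne_zero.2 hrs) (sub_ne_zero.2 hrt)
    positivity
  simpa using this

theorem isOrdinaryFlat_momentHyperplane {e n : ℕ} {t : Fin n → ℝ} (ht : StrictMono t)
    {i j : Fin n} (hij : i < j) :
    IsOrdinaryFlat (⋃ i, momentCell t i)ᶜ (e + 2) (momentHyperplane e (t i) (t j)) := by
  obtain ⟨p, hp, hlt⟩ := exists_momentFun_eq_and_lt e (t i) (t j)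
  let U : Set (EuclideanSpace ℝ (Fin (e + 3))) := ⋂ k : {k // k ≠ i ∧ k ≠ j},
    {x | momentFun (t k) x < momentFun (t i) x} ∩ {x | momentFun (t k) x < momentFun (t j) x}
  have hU : IsOpen U := isOpen_iInter_of_finite fun k =>
    (isOpen_lt (continuous_momentFun _) (continuous_momentFun _)).inter
      (isOpen_lt (continuous_momentFun _) (continuous_momentFun _))
  have hpU : p ∈ U := by
    refine mem_iInter.2 fun k => ?_
    have := hlt (t k) (ht.injective.ne k.2.1) (ht.injective.ne k.2.2)
    exact ⟨this, this.trans_eq hp⟩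
  have hpH : p ∈ momentHyperplane e (t i) (t j) :=
    (mem_momentHyperplane_iff_momentFun_eq (ht hij).ne).2 hp
  have hSU : (⋃ i, momentCell t i)ᶜ ∩ U =
      (momentHyperplane e (t i) (t j) : Set (EuclideanSpace ℝ (Fin (e + 3)))) ∩ U := by
    ext x
    refine and_congr_left fun hxU => ?_
    have hxU' : ∀ k, k ≠ i → k ≠ j → momentFun (t k) x < momentFun (t i) x ∧
        momentFun (t k) x < momentFun (t j) x := fun k hki hkj => mem_iInter.1 hxU ⟨k, hki, hkj⟩
    rw [SetLike.mem_coe, mem_momentHyperplane_iff_momentFun_eq (ht hij).ne, mem_compl_iff,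
      mem_iUnion, not_exists]
    constructor
    · intro hx
      by_contra hne
      rcases lt_or_gt_of_ne hne with h | h
      · refine hx j fun k hk => ?_
        rcases eq_or_ne k i with rfl | hki
        · exact h
        · exact (hxU' k hki hk).2
      · refine hx i fun k hk => ?_
        rcases eq_or_ne k j with rfl | hkj
        · exact h
        · exact (hxU' k hk hkj).1
    · intro hx k hk
      rcases eq_or_ne k i with rfl | hki
      · exact (hk j hij.ne').ne hx.symm
      rcases eq_or_ne k j with rfl | hkj
      · exact (hk i hij.ne).ne hx
      · exact (hk i hki.symm).asymm (hxU' k hki hkj).1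
  refine ⟨finrank_direction_momentHyperplane _ _ _, p, (hSU.symm.subset ⟨hpH, hpU⟩).1, ?_,
    U, hU, hpU, hSU⟩
  rw [dmLoc_eq_finrank_direction hU hpU hpH hSU, finrank_direction_momentHyperplane]

theorem IsOrdinaryFlat.exists_eq_momentHyperplane {e n : ℕ} (hn : 1 ≤ n) {t : Fin n → ℝ}
    (ht : StrictMono t) {H : AffineSubspace ℝ (EuclideanSpace ℝ (Fin (e + 3)))}
    (hH : IsOrdinaryFlat (⋃ i, momentCell t i)ᶜ (e + 2) H) :
    ∃ i j, i < j ∧ momentHyperplane e (t i) (t j) = H := by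
  obtain ⟨hdim, p, hpS, -, U, hU, hpU, hSU⟩ := hH
  have hpH : p ∈ H := (hSU.subset ⟨hpS, hpU⟩).1
  obtain ⟨⟨⟨i, j⟩, hij⟩, hle⟩ := AffineSubspace.exists_le_of_inter_subset_iUnion hpH hU hpU
    (F := fun q : {q : Fin n × Fin n // q.1 < q.2} => momentHyperplane e (t q.1.1) (t q.1.2)) <| by
      intro x hx
      obtain ⟨i, j, hij, hxij⟩ :=
        exists_mem_momentHyperplane_of_notMem_momentCell hn ht (hSU.symm.subset hx).1
      exact mem_iUnion.2 ⟨⟨(i, j), hij⟩, hxij⟩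
  refine ⟨i, j, hij, (AffineSubspace.eq_of_direction_eq_of_nonempty_of_le ?_ ⟨p, hpH⟩ hle).symm⟩
  exact Submodule.eq_of_le_of_finrank_eq (AffineSubspace.direction_le hle)
    (by rw [hdim, finrank_direction_momentHyperplane])

/-- For every `d ≥ 3` and `n ≥ 1` there are `n` convex sets in `ℝ^d` whose complement
has exactly `C(n,2)` ordinary hyperplanes (i.e. `(d-1)`-ordinary flats). -/
theorem exists_ordinary_hyperplanes_card_eq (d n : ℕ) (hd : 3 ≤ d) (hn : 1 ≤ n) :
    ∃ K : Fin n → Set (EuclideanSpace ℝ (Fin d)),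
      (∀ i, Convex ℝ (K i)) ∧
      {H : AffineSubspace ℝ (EuclideanSpace ℝ (Fin d)) |
        IsOrdinaryFlat (⋃ i, K i)ᶜ (d - 1) H}.encard = (n.choose 2 : ℕ∞) := by
  obtain ⟨e, rfl⟩ := Nat.exists_eq_add_of_le' hd
  have ht : StrictMono fun i : Fin n => ((i : ℕ) : ℝ) := fun i j h => by simpa using h
  refine ⟨momentCell fun i => ((i : ℕ) : ℝ), convex_momentCell _, ?_⟩
  have himage : {H : AffineSubspace ℝ (EuclideanSpace ℝ (Fin (e + 3))) |
      IsOrdinaryFlat (⋃ i, momentCell (fun i : Fin n => ((i : ℕ) : ℝ)) i)ᶜ (e + 3 - 1) H} =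
      (fun q : Σ _ : ℕ, ℕ => momentHyperplane e q.2 q.1) ''
        ((Finset.range n).sigma Finset.range : Finset (Σ _ : ℕ, ℕ)) := by
    ext H
    constructor
    · intro hH
      obtain ⟨i, j, hij, rfl⟩ := IsOrdinaryFlat.exists_eq_momentHyperplane hn ht hH
      exact ⟨⟨j, i⟩, by simpa using hij, rfl⟩
    · rintro ⟨⟨j, i⟩, hq, rfl⟩
      simp only [Finset.mem_coe, Finset.mem_sigma, Finset.mem_range] at hq
      exact isOrdinaryFlat_momentHyperplane ht (i := ⟨i, hq.2.trans hq.1⟩) (j := ⟨j, hq.1⟩) hq.2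
  have hinj : InjOn (fun q : Σ _ : ℕ, ℕ => momentHyperplane e q.2 q.1)
      ((Finset.range n).sigma Finset.range : Finset (Σ _ : ℕ, ℕ)) := by
    rintro ⟨j, i⟩ hq ⟨j', i'⟩ hq' h
    simp only [Finset.mem_coe, Finset.mem_sigma, Finset.mem_range] at hq hq'
    obtain ⟨hi, hj⟩ := momentHyperplane_injective (Nat.cast_lt.2 hq.2) (Nat.cast_lt.2 hq'.2) h
    simp_all
  rw [himage, hinj.encard_image, encard_coe_eq_coe_finsetCard, Finset.card_sigma]
  simp [Finset.sum_range_id, Nat.choose_two_right]
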